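/- arXiv:math/0001148 — 2 statements merged into one kernel-verified Lean document; each statement's English description precedes it below -/
import Mathlib

section
/- Let P be an arbitrary partial order. Then the map p ↦ UP(p) = {x ∈ P* : x(p) = 1} is an order isomorphism from P onto C1O2(P*, C1, C2) ordered by set inclusion. -/
open Set

variable {P : Type*}

/-- `UP_A(p) = {x ∈ A : x p = 1}`, as a subset of the subtype `↥A`. -/
def UPa [PartialOrder P] (A : Set (P →o Bool)) (p : P) : Set ↥A := {x | x.1 p = true}

/-- `LO_A(p) = {x ∈ A : x p = 0}`, as a subset of the subtype `↥A`. -/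
def LOa [PartialOrder P] (A : Set (P →o Bool)) (p : P) : Set ↥A := {x | x.1 p = false}

/-- The closure operator generated by a family `K` of subsets of `M`:
`C(X) = ⋂ {k ∈ K : X ⊆ k}` (the empty intersection being `M`). -/
def closGen {M : Type*} (K : Set (Set M)) (X : Set M) : Set M := ⋂₀ {k ∈ K | X ⊆ k}

/-- The closure `C1` on `A` generated by `{UP_A(p) : p ∈ P}`. -/
def C1a [PartialOrder P] (A : Set (P →o Bool)) : Set ↥A → Set ↥A :=
  closGen (Set.range (UPa A))

/-- The closure `C2` on `A` generated by `{LO_A(p) : p ∈ P}`. -/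
def C2a [PartialOrder P] (A : Set (P →o Bool)) : Set ↥A → Set ↥A :=
  closGen (Set.range (LOa A))

/-- `C1O2(A)`: the subsets of `A` that are `C1`-closed and `C2`-open. -/
def C1O2 [PartialOrder P] (A : Set (P →o Bool)) : Set (Set ↥A) :=
  {B | C1a A B = B ∧ C2a A Bᶜ = Bᶜ}

/-- An `A`-ideal: an intersection of kernels of elements of some `S ⊆ A`. -/
def IsIdealOf [PartialOrder P] (A : Set (P →o Bool)) (I : Set P) : Prop :=
  ∃ S ⊆ A, I = ⋂ x ∈ S, {p : P | x p = false}

/-- An `A`-filter: an intersection of co-kernels of elements of some `S ⊆ A`. -/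
def IsFilterOf [PartialOrder P] (A : Set (P →o Bool)) (F : Set P) : Prop :=
  ∃ S ⊆ A, F = ⋂ x ∈ S, {p : P | x p = true}

/-- `A` is full: for all `p ≰ q` some `x ∈ A` has `x p = 1`, `x q = 0`. -/
def IsFullSet [PartialOrder P] (A : Set (P →o Bool)) : Prop :=
  ∀ p q : P, ¬ p ≤ q → ∃ x ∈ A, x p = true ∧ x q = false

/-- `A` is separating: any disjoint `A`-ideal and `A`-filter are separated by some `x ∈ A`. -/
def IsSeparatingSet [PartialOrder P] (A : Set (P →o Bool)) : Prop :=
  ∀ I F : Set P, IsIdealOf A I → IsFilterOf A F → I ∩ F = ∅ →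
    ∃ x ∈ A, (∀ p ∈ I, x p = false) ∧ (∀ p ∈ F, x p = true)

theorem subset_closGen {M : Type*} (K : Set (Set M)) (X : Set M) : X ⊆ closGen K X :=
  fun _ hx _ hk => hk.2 hx

theorem closGen_eq_of_mem {M : Type*} {K : Set (Set M)} {X : Set M} (hX : X ∈ K) :
    closGen K X = X :=
  Subset.antisymm (sInter_subset_of_mem (S := {k ∈ K | X ⊆ k}) ⟨hX, Subset.rfl⟩)
    (subset_closGen K X)

theorem compl_UPa [PartialOrder P] (A : Set (P →o Bool)) (p : P) : (UPa A p)ᶜ = LOa A p := by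
  ext x
  simp [UPa, LOa]

open Classical in
/-- The characteristic map of an upper set, as a monotone map to the two-element chain. -/
noncomputable def UpperSet.toBoolHom [PartialOrder P] (F : UpperSet P) : P →o Bool where
  toFun p := decide (p ∈ F)
  monotone' _ _ hpq := Bool.le_iff_imp.2 fun hp =>
    decide_eq_true (F.upper hpq (of_decide_eq_true hp))

theorem UpperSet.toBoolHom_eq_true [PartialOrder P] {F : UpperSet P} {p : P} :
    F.toBoolHom p = true ↔ p ∈ F :=
  @decide_eq_true_iff _ (Classical.propDecidable _)

theorem UPa_mono [PartialOrder P] (A : Set (P →o Bool)) : Monotone (UPa A) :=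
  fun _ _ hpq x hx => x.1.monotone hpq hx

theorem UPa_univ_subset_iff [PartialOrder P] {p q : P} :
    UPa (univ : Set (P →o Bool)) p ⊆ UPa univ q ↔ p ≤ q := by
  refine ⟨fun h => ?_, fun h => UPa_mono _ h⟩
  have hp : (⟨(UpperSet.Ici p).toBoolHom, mem_univ _⟩ : (univ : Set (P →o Bool))) ∈ UPa univ p :=
    UpperSet.toBoolHom_eq_true.2 (UpperSet.mem_Ici_iff.2 le_rfl)
  exact UpperSet.mem_Ici_iff.1 (UpperSet.toBoolHom_eq_true.1 (h hp))

theorem UPa_mem_C1O2 [PartialOrder P] (A : Set (P →o Bool)) (p : P) : UPa A p ∈ C1O2 A := by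
  refine ⟨closGen_eq_of_mem ⟨p, rfl⟩, ?_⟩
  rw [compl_UPa]
  exact closGen_eq_of_mem ⟨p, rfl⟩

theorem exists_UPa_eq_of_mem_C1O2 [PartialOrder P] {B : Set (univ : Set (P →o Bool))}
    (hB : B ∈ C1O2 univ) : ∃ p : P, UPa univ p = B := by
  obtain ⟨h₁, h₂⟩ := hB
  let F : UpperSet P := ⟨{p | B ⊆ UPa univ p}, fun _ _ hpq hp => hp.trans (UPa_mono _ hpq)⟩
  let x : (univ : Set (P →o Bool)) := ⟨F.toBoolHom, mem_univ _⟩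
  have hxB : x ∈ B := by
    rw [← h₁]
    rintro _ ⟨⟨p, rfl⟩, hp⟩
    exact UpperSet.toBoolHom_eq_true.2 hp
  have hx : x ∉ C2a univ Bᶜ := by
    rw [h₂]
    exact not_not_intro hxB
  obtain ⟨p, hpB, hpx⟩ : ∃ p, Bᶜ ⊆ LOa univ p ∧ x ∉ LOa univ p := by
    by_contra! h
    refine hx ?_
    rintro _ ⟨⟨p, rfl⟩, hp⟩
    exact h p hp
  rw [← compl_UPa, notMem_compl_iff] at hpx
  rw [← compl_UPa, compl_subset_compl] at hpB
  exact ⟨p, hpB.antisymm (UpperSet.toBoolHom_eq_true.1 hpx)⟩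

/-- for an arbitrary poset `P`, the map `p ↦ UP(p)` is an order
isomorphism from `P` onto `C1O2(P*, C1, C2)` ordered by set inclusion. -/
theorem stmt6 [PartialOrder P] :
    (∀ p : P, UPa (Set.univ : Set (P →o Bool)) p ∈ C1O2 Set.univ) ∧
    Function.Injective (UPa (Set.univ : Set (P →o Bool))) ∧
    (∀ B ∈ C1O2 (Set.univ : Set (P →o Bool)), ∃ p : P, UPa Set.univ p = B) ∧
    (∀ p q : P, p ≤ q ↔
      UPa (Set.univ : Set (P →o Bool)) p ⊆ UPa (Set.univ : Set (P →o Bool)) q) := by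
  refine ⟨UPa_mem_C1O2 _, fun p q h => ?_, fun B hB => exists_UPa_eq_of_mem_C1O2 hB,
    fun p q => UPa_univ_subset_iff.symm⟩
  exact (UPa_univ_subset_iff.1 h.subset).antisymm (UPa_univ_subset_iff.1 h.superset)
end

section
/- For any distributive lattice L, the set L^{*∧∨} of lattice homomorphisms from L to the two-element chain is full and separating. -/
open Set

variable {P : Type*}

/-- `L^{*∧∨}`: the monotone maps `L → 2` preserving binary meets and joins. -/
def LatHoms (L : Type*) [Lattice L] : Set (L →o Bool) :=
  {x | ∀ p q : L, x (p ⊓ q) = (x p && x q) ∧ x (p ⊔ q) = (x p || x q)}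

open Classical in
/-- The indicator of the complement of a prime ideal is a lattice homomorphism to `Bool`. -/
theorem exists_mem_latHoms_of_isPrime {L : Type*} [Lattice L] (J : Order.Ideal L)
    (hJ : J.IsPrime) : ∃ x ∈ LatHoms L, ∀ p, x p = false ↔ p ∈ J := by
  refine ⟨⟨fun p => decide (p ∉ J), fun p q hpq => ?_⟩, fun p q => ⟨?_, ?_⟩, fun p => ?_⟩
  · by_cases hq : q ∈ J
    · have hp : p ∈ J := J.lower hpq hq
      simp [hp]
    · simp [hq]
  · have h : p ⊓ q ∈ J ↔ p ∈ J ∨ q ∈ J :=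
      ⟨hJ.mem_or_mem, fun h => h.elim (J.lower inf_le_left) (J.lower inf_le_right)⟩
    change decide _ = (decide _ && decide _)
    rw [← Bool.decide_and, decide_eq_decide, h, not_or]
  · have h : p ⊔ q ∈ J ↔ p ∈ J ∧ q ∈ J := Order.Ideal.sup_mem_iff
    change decide _ = (decide _ || decide _)
    rw [← Bool.decide_or, decide_eq_decide, h, not_and_or]
  · change decide _ = false ↔ _
    simp

/-- A constant map to `Bool` is a lattice homomorphism. -/
theorem const_mem_latHoms (L : Type*) [Lattice L] (b : Bool) :
    OrderHom.const L b ∈ LatHoms L := by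
  intro p q
  simp

/-- Disjoint, possibly empty, order ideals and filters of a distributive lattice are separated by
a lattice homomorphism to `Bool`. -/
theorem exists_mem_latHoms_of_disjoint {L : Type*} [DistribLattice L] {I F : Set L}
    (hI : IsLowerSet I) (hIsup : SupClosed I) (hF : IsUpperSet F) (hFinf : InfClosed F)
    (hIF : Disjoint F I) :
    ∃ x ∈ LatHoms L, (∀ p ∈ I, x p = false) ∧ (∀ p ∈ F, x p = true) := by
  rcases I.eq_empty_or_nonempty with rfl | hIne
  · exact ⟨_, const_mem_latHoms L true, by simp, by simp⟩
  rcases F.eq_empty_or_nonempty with rfl | hFne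
  · exact ⟨_, const_mem_latHoms L false, by simp, by simp⟩
  have hI' : Order.IsIdeal I :=
    ⟨hI, hIne, fun a ha b hb => ⟨a ⊔ b, hIsup ha hb, le_sup_left, le_sup_right⟩⟩
  have hF' : Order.IsPFilter F := Order.IsPFilter.of_def hFne
    (fun a ha b hb => ⟨a ⊓ b, hFinf ha hb, inf_le_left, inf_le_right⟩)
    (fun {_ _} hab ha => hF hab ha)
  obtain ⟨J, hJ, hIJ, hFJ⟩ := DistribLattice.prime_ideal_of_disjoint_filter_ideal
    (F := hF'.toPFilter) (I := hI'.toIdeal) hIF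
  obtain ⟨x, hx, hxJ⟩ := exists_mem_latHoms_of_isPrime J hJ
  refine ⟨x, hx, fun p hp => (hxJ p).2 (hIJ hp), fun p hp => ?_⟩
  rw [← Bool.not_eq_false, hxJ]
  exact Set.disjoint_left.1 hFJ hp

/-- for any distributive lattice `L`, the set `L^{*∧∨}` of lattice
homomorphisms to the two-element chain is full and separating. -/
theorem stmt13 {L : Type*} [DistribLattice L] :
    IsFullSet (LatHoms L) ∧ IsSeparatingSet (LatHoms L) := by
  refine ⟨fun p q hpq => ?_, ?_⟩
  · obtain ⟨x, hx, hxI, hxF⟩ := exists_mem_latHoms_of_disjoint (isLowerSet_Iic q)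
      (fun _ ha _ hb => sup_le ha hb) (isUpperSet_Ici p) (fun _ ha _ hb => le_inf ha hb)
      (Set.disjoint_left.2 fun _ ha hb => hpq (le_trans ha hb))
    exact ⟨x, hx, hxF p le_rfl, hxI q le_rfl⟩
  · rintro I F ⟨S, hS, rfl⟩ ⟨T, hT, rfl⟩ hIF
    refine exists_mem_latHoms_of_disjoint ?_ ?_ ?_ ?_
      (Set.disjoint_iff_inter_eq_empty.2 hIF).symm
    · refine isLowerSet_iInter₂ fun x _ a b hba (ha : x a = false) => ?_
      exact le_bot_iff.1 ((x.monotone hba).trans ha.le)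
    · intro a ha b hb
      simp only [Set.mem_iInter, Set.mem_ofPred_eq] at ha hb ⊢
      intro x hx
      rw [(hS hx a b).2, ha x hx, hb x hx, Bool.or_false]
    · refine isUpperSet_iInter₂ fun x _ a b hab (ha : x a = true) => ?_
      exact top_le_iff.1 (ha.ge.trans (x.monotone hab))
    · intro a ha b hb
      simp only [Set.mem_iInter, Set.mem_ofPred_eq] at ha hb ⊢
      intro x hx
      rw [(hT hx a b).1, ha x hx, hb x hx, Bool.and_true]
end
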